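/- For any natural numbers a, b and any finite multiset M of natural numbers, the map λ ∘ swap ∘ mir ∘ τ is an involution on the set L_{a,M,b}: it maps L_{a,M,b} to itself and applying it twice gives the identity. Moreover, this involution exchanges the statistics area and depth, i.e., for P ∈ L_{a,M,b} and P' = λ(swap(mir(τ(P)))), one has area(P') = depth(P) and depth(P') = area(P). -/

import Mathlib

/-! ## Plane trees -/

/-- A plane tree: a root together with an ordered (left-to-right) list of subtrees.
A node is a *leaf* if it has no children, and *internal* otherwise. -/
inductive PTree : Type where
  | node : List PTree → PTree


namespace Luka

/-! ## Łukasiewicz paths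

A path is encoded by its list of step increments: the step `(1,k)` (an up-step `U_k` of
degree `k`) is encoded by `k : ℤ` with `k ≥ 0`, and the down step `D = (1,-1)` by `-1`. -/

/-- `P` is a Łukasiewicz path: it is nonempty, uses steps `(1,k)` with `k ≥ -1`,
stays (weakly) above the `x`-axis before its last step, and ends at height `-1`
(so that it goes strictly below the axis only at the last step, which is forced
to be the down-step `D`). -/
def IsLukas (P : List ℤ) : Prop :=
  P ≠ [] ∧ (∀ s ∈ P, -1 ≤ s) ∧ (∀ n, n < P.length → 0 ≤ (P.take n).sum) ∧ P.sum = -1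

/-- The degrees of the up-steps of `P`, from left to right (the *profile* of `P`). -/
def upDegs (P : List ℤ) : List ℕ := (P.filter (fun s => 0 ≤ s)).map Int.toNat

/-- The profile multiset `𝔐(P)`: the multiset of degrees of the up-steps of `P`. -/
def profileM (P : List ℤ) : Multiset ℕ := (upDegs P : Multiset ℕ)

/-- The degree of the first up-step of `P`, if any. -/
def firstUp? (P : List ℤ) : Option ℕ := (upDegs P).head?

/-- The degree of the last up-step of `P`, if any. -/
def lastUp? (P : List ℤ) : Option ℕ := (upDegs P).getLast?

/-- Auxiliary: starting from height `h`, record the starting height of every up-step. -/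
def areaVecAux : ℤ → List ℤ → List ℤ
  | _, [] => []
  | h, s :: rest => (if 0 ≤ s then [h] else []) ++ areaVecAux (h + s) rest

/-- The area vector `Area(P)`: the `i`-th entry is the `y`-coordinate of the starting
point of the `i`-th up-step of `P`. -/
def areaVec (P : List ℤ) : List ℤ := areaVecAux 0 P

/-- `area(P)`: the sum of the entries of the area vector (entries of a Łukasiewicz
path are nonnegative, so taking `Int.toNat` entrywise is harmless). -/
def area (P : List ℤ) : ℕ := ((areaVec P).map Int.toNat).sum

/-- Auxiliary computation of the depth values: `cur` is the depth value of the previous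
step (`0` initially), and `stack` holds the pending depth values of the future matching
down-steps (top of the stack = value for the next matching down-step to come).
Reading an up-step `U_k` whose value is `cur` (inherited from the previous step) pushes
the values `cur+1, …, cur+k` for its `k` matching down-steps (its first matching
down-step, which crosses its topmost interior level, gets `cur+1`, etc.); reading a
down-step pops its value.  The list returned records the value `d_i` of each up-step,
from left to right. -/
def depthVecAux : ℕ → List ℕ → List ℤ → List ℕ
  | _, _, [] => []
  | cur, stack, s :: rest =>
    if 0 ≤ s then
      cur :: depthVecAux cur ((List.range s.toNat).map (fun i => cur + i + 1) ++ stack) rest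
    else
      match stack with
      | [] => depthVecAux cur [] rest
      | v :: st => depthVecAux v st rest

/-- The depth vector `Depth(P)`: the values `d_i` at the up-steps of `P`, left to right. -/
def depthVec (P : List ℤ) : List ℕ := depthVecAux 0 [] P

/-- `depth(P)`: the sum of the entries of the depth vector. -/
def depth (P : List ℤ) : ℕ := (depthVec P).sum

/-- `P ∈ 𝓛_M`. -/
def MemL (M : Multiset ℕ) (P : List ℤ) : Prop := IsLukas P ∧ profileM P = M

/-- `P ∈ 𝓛_{a,M}`: first up-step of degree `a`, profile multiset `M ⊎ {a}`. -/
def MemLa (a : ℕ) (M : Multiset ℕ) (P : List ℤ) : Prop :=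
  IsLukas P ∧ firstUp? P = some a ∧ profileM P = a ::ₘ M

/-- `P ∈ 𝓛_{M,b}`: last up-step of degree `b`, profile multiset `M ⊎ {b}`. -/
def MemLb (M : Multiset ℕ) (b : ℕ) (P : List ℤ) : Prop :=
  IsLukas P ∧ lastUp? P = some b ∧ profileM P = b ::ₘ M

/-- `P ∈ 𝓛_{a,M,b}`: first up-step of degree `a`, last up-step of degree `b`,
profile multiset `M ⊎ {a, b}`. -/
def MemLab (a : ℕ) (M : Multiset ℕ) (b : ℕ) (P : List ℤ) : Prop :=
  IsLukas P ∧ firstUp? P = some a ∧ lastUp? P = some b ∧ profileM P = a ::ₘ b ::ₘ M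

/-! ## Plane-tree statistics -/

/-- The (ordered) children of the root of a plane tree. -/
def children : PTree → List PTree
  | .node ts => ts

/-- The degree of (the root of) a plane tree: its number of children. -/
def numChildren (t : PTree) : ℕ := (children t).length

mutual
/-- Number of internal nodes of a plane tree. -/
def internCount : PTree → ℕ
  | .node [] => 0
  | .node (t :: ts) => 1 + internCountL (t :: ts)
def internCountL : List PTree → ℕ
  | [] => 0
  | t :: ts => internCount t + internCountL ts
end

mutual
/-- `lthornT T` = the sum of `lthorn(u)` over all internal nodes `u` of `T`, where
`lthorn(u)` is the number of descending edges of strict ancestors `v` of `u` lying to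
the left of the path from `v` to `u`.  (Every internal node of the subtree rooted at
the `i`-th child (0-indexed) of a node gains `i` left thorns from that node.) -/
def lthornT : PTree → ℕ
  | .node ts => lthornL 0 ts
def lthornL : ℕ → List PTree → ℕ
  | _, [] => 0
  | i, t :: ts => lthornT t + i * internCount t + lthornL (i + 1) ts
end

mutual
/-- `rthornT T` = the sum of `rthorn(u)` over all internal nodes `u` of `T`, where
`rthorn(u)` is the number of descending edges of strict ancestors `v` of `u` lying to
the right of the path from `v` to `u`. -/
def rthornT : PTree → ℕ
  | .node ts => rthornL ts
def rthornL : List PTree → ℕ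
  | [] => 0
  | t :: ts => rthornT t + ts.length * internCount t + rthornL ts
end

mutual
/-- The list of the values `lthorn(u)` for the internal nodes `u` of `T`, in
contour-walk (preorder) order. -/
def lthornList : PTree → List ℕ
  | .node [] => []
  | .node (t :: ts) => 0 :: lthornLL 0 (t :: ts)
def lthornLL : ℕ → List PTree → List ℕ
  | _, [] => []
  | i, t :: ts => (lthornList t).map (· + i) ++ lthornLL (i + 1) ts
end

mutual
/-- The list of the values `rthorn(u)` for the internal nodes `u` of `T`, in
contour-walk (preorder) order. -/
def rthornList : PTree → List ℕ
  | .node [] => []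
  | .node (t :: ts) => 0 :: rthornLL (t :: ts)
def rthornLL : List PTree → List ℕ
  | [] => []
  | t :: ts => (rthornList t).map (· + ts.length) ++ rthornLL ts
end

/-! ## The bijections `λ` and `τ` -/

mutual
/-- `λ`: record each node of the tree at its first visit in the left-to-right contour
walk: `U_k` (i.e. `k`) for an internal node with `k+1` children, `D` (i.e. `-1`)
for a leaf. -/
def lambdaT : PTree → List ℤ
  | .node ts => ((ts.length : ℤ) - 1) :: lambdaL ts
def lambdaL : List PTree → List ℤ
  | [] => []
  | t :: ts => lambdaT t ++ lambdaL ts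
end

/-- Auxiliary for `τ`: reading the path from right to left, maintain the stack of the
already-built subtrees (in left-to-right order); a down-step `D` creates a leaf and an
up-step `U_k` grabs the `k+1` topmost subtrees as its children.  This builds the same
tree as the left-to-right "leftmost bud" construction. -/
def tauStack (P : List ℤ) : List PTree :=
  P.foldr (fun s st =>
    if s < 0 then PTree.node [] :: st
    else PTree.node (st.take (s.toNat + 1)) :: st.drop (s.toNat + 1)) []

/-- `τ`: the plane tree associated with a Łukasiewicz path. -/
def tau (P : List ℤ) : PTree := (tauStack P).headD (.node [])

mutual
/-- The mirror of a plane tree: reverse the left-to-right order of the children of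
every internal node. -/
def mir : PTree → PTree
  | .node ts => .node (mirL ts).reverse
def mirL : List PTree → List PTree
  | [] => []
  | t :: ts => mir t :: mirL ts
end

mutual
/-- The subtrees rooted at the internal nodes of `T`, in contour-walk (preorder)
order. -/
def internalSubtrees : PTree → List PTree
  | .node [] => []
  | .node (t :: ts) => .node (t :: ts) :: internalSubtreesL (t :: ts)
def internalSubtreesL : List PTree → List PTree
  | [] => []
  | t :: ts => internalSubtrees t ++ internalSubtreesL ts
end

/-- The multiset of degrees of the non-root internal nodes of `T`. -/
def nonRootInternalDegs (T : PTree) : Multiset ℕ :=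
  (((internalSubtreesL (children T)).map numChildren : List ℕ) : Multiset ℕ)

/-! ## Lodestars and the lodestar swap -/

/-- A node is a lodestar-type node if it is internal and all its children are leaves. -/
def isLodestarNode (t : PTree) : Bool :=
  !(children t).isEmpty && (children t).all (fun c => (children c).isEmpty)

mutual
/-- The subtree rooted at the *left lodestar* of `T`: the first internal node, in
contour-walk (preorder) order, all of whose children are leaves (if it exists). -/
def leftLode? : PTree → Option PTree
  | .node ts =>
    if isLodestarNode (.node ts) then some (.node ts) else leftLodeL? ts
def leftLodeL? : List PTree → Option PTree
  | [] => none
  | t :: ts =>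
    match leftLode? t with
    | some r => some r
    | none => leftLodeL? ts
end

mutual
/-- The subtree rooted at the *right lodestar* of `T`: the last internal node, in
contour-walk (preorder) order, all of whose children are leaves (if it exists). -/
def rightLode? : PTree → Option PTree
  | .node ts =>
    match rightLodeL? ts with
    | some r => some r
    | none => if isLodestarNode (.node ts) then some (.node ts) else none
def rightLodeL? : List PTree → Option PTree
  | [] => none
  | t :: ts =>
    match rightLodeL? ts with
    | some r => some r
    | none => rightLode? t
end

mutual
/-- Replace the left lodestar of `T` (first preorder all-leaf-children internal node)
by the tree `r`; `none` if `T` has no internal node. -/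
def replF : PTree → PTree → Option PTree
  | r, .node ts =>
    if isLodestarNode (.node ts) then some r
    else (replFL r ts).map PTree.node
def replFL : PTree → List PTree → Option (List PTree)
  | _, [] => none
  | r, t :: ts =>
    match replF r t with
    | some t' => some (t' :: ts)
    | none => (replFL r ts).map (t :: ·)
end

mutual
/-- Replace the right lodestar of `T` (last preorder all-leaf-children internal node)
by the tree `r`; `none` if `T` has no internal node. -/
def replL : PTree → PTree → Option PTree
  | r, .node ts =>
    match replLL r ts with
    | some ts' => some (.node ts')
    | none => if isLodestarNode (.node ts) then some r else none
def replLL : PTree → List PTree → Option (List PTree)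
  | _, [] => none
  | r, t :: ts =>
    match replLL r ts with
    | some ts' => some (t :: ts')
    | none => (replL r t).map (· :: ts)
end

/-- The lodestar swap: exchange the subtrees rooted at the left lodestar and the
right lodestar of `T` (each a node together with its pendant leaves). -/
def lodeSwap (T : PTree) : PTree :=
  match leftLode? T, rightLode? T with
  | some L, some R => ((replF R T).bind (replL L)).getD T
  | _, _ => T

end Luka

namespace Luka

theorem forest_induction {p : PTree → Prop} {q : List PTree → Prop}
    (node : ∀ ts, q ts → p (.node ts)) (nil : q [])
    (cons : ∀ t ts, p t → q ts → q (t :: ts)) : (∀ t, p t) ∧ ∀ ts, q ts :=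
  ⟨fun t => PTree.rec (motive_1 := p) (motive_2 := q) node nil cons t,
   fun ts => PTree.rec_1 (motive_1 := p) (motive_2 := q) node nil cons ts⟩

/-! ## Łukasiewicz paths and plane trees -/

/-- All steps are at least `-1` and every nonempty suffix has negative sum: the paths encoding
ordered forests. -/
def IsForestPath : List ℤ → Prop
  | [] => True
  | s :: P => -1 ≤ s ∧ s + P.sum ≤ -1 ∧ IsForestPath P

theorem IsForestPath.sum_nonpos {P : List ℤ} (h : IsForestPath P) : P.sum ≤ 0 := by
  cases P with
  | nil => simp
  | cons s P => simp only [IsForestPath] at h; simp only [List.sum_cons]; omega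

theorem IsForestPath.append {P Q : List ℤ} (hP : IsForestPath P) (hQ : IsForestPath Q) :
    IsForestPath (P ++ Q) := by
  induction P with
  | nil => exact hQ
  | cons s P ih =>
    have := hQ.sum_nonpos
    refine ⟨hP.1, ?_, ih hP.2.2⟩
    have := hP.2.1
    change s + (P ++ Q).sum ≤ -1
    rw [List.sum_append]; omega

theorem isForestPath_iff (P : List ℤ) :
    IsForestPath P ↔ (∀ s ∈ P, -1 ≤ s) ∧ ∀ n, n < P.length → (P.drop n).sum ≤ -1 := by
  induction P with
  | nil => simp [IsForestPath]
  | cons s P ih =>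
    rw [IsForestPath, ih]
    constructor
    · rintro ⟨h1, h2, h3, h4⟩
      refine ⟨by simpa using ⟨h1, h3⟩, fun n hn => ?_⟩
      cases n with
      | zero => simpa using h2
      | succ n => exact h4 n (by simpa using hn)
    · rintro ⟨h1, h2⟩
      refine ⟨h1 s (by simp), by simpa using h2 0 (by simp), fun x hx => h1 x (by simp [hx]),
        fun n hn => by simpa using h2 (n + 1) (by simpa using hn)⟩

theorem isLukas_iff (P : List ℤ) : IsLukas P ↔ IsForestPath P ∧ P.sum = -1 := by
  rw [isForestPath_iff, IsLukas]
  have key : ∀ n, (P.take n).sum + (P.drop n).sum = P.sum := fun n => by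
    rw [← List.sum_append, List.take_append_drop]
  constructor
  · rintro ⟨-, h1, h2, h3⟩
    refine ⟨⟨h1, fun n hn => ?_⟩, h3⟩
    have := key n
    have := h2 n hn
    omega
  · rintro ⟨⟨h1, h2⟩, h3⟩
    refine ⟨by rintro rfl; simp at h3, h1, fun n hn => ?_, h3⟩
    have := key n
    have := h2 n hn
    omega

theorem isForestPath_lambda :
    (∀ t, IsForestPath (lambdaT t) ∧ (lambdaT t).sum = -1) ∧
      ∀ ts, IsForestPath (lambdaL ts) ∧ (lambdaL ts).sum = -(ts.length : ℤ) := by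
  refine forest_induction ?_ ?_ ?_
  · rintro ts ⟨h1, h2⟩
    simp only [lambdaT, IsForestPath, List.sum_cons, h2]
    exact ⟨⟨by omega, by omega, h1⟩, by omega⟩
  · simp [lambdaL, IsForestPath]
  · rintro t ts ⟨h1, h2⟩ ⟨h3, h4⟩
    refine ⟨h1.append h3, ?_⟩
    simp only [lambdaL, List.sum_append, h2, h4, List.length_cons]
    omega

theorem isLukas_lambdaT (t : PTree) : IsLukas (lambdaT t) :=
  (isLukas_iff _).2 (isForestPath_lambda.1 t)

theorem tauStack_cons (s : ℤ) (P : List ℤ) :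
    tauStack (s :: P) = if s < 0 then PTree.node [] :: tauStack P
      else PTree.node ((tauStack P).take (s.toNat + 1)) :: (tauStack P).drop (s.toNat + 1) :=
  rfl

theorem tauStack_lambda_append :
    (∀ t rest, tauStack (lambdaT t ++ rest) = t :: tauStack rest) ∧
      ∀ ts rest, tauStack (lambdaL ts ++ rest) = ts ++ tauStack rest := by
  refine forest_induction ?_ ?_ ?_
  · intro ts ih rest
    rw [lambdaT, List.cons_append, tauStack_cons, ih]
    cases ts with
    | nil => simp
    | cons t ts =>
      have h : ¬ (((t :: ts).length : ℤ) - 1 < 0) := by simp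
      have h' : (((t :: ts).length : ℤ) - 1).toNat + 1 = (t :: ts).length := by simp
      rw [if_neg h, h', List.take_left, List.drop_left]
  · simp [lambdaL]
  · intro t ts h1 h2 rest
    rw [lambdaL, List.append_assoc, h1, h2, List.cons_append]

theorem tau_lambdaT (t : PTree) : tau (lambdaT t) = t := by
  have := tauStack_lambda_append.1 t []
  rw [List.append_nil] at this
  simp [tau, this]

theorem lambdaL_append (ts us : List PTree) :
    lambdaL (ts ++ us) = lambdaL ts ++ lambdaL us := by
  induction ts with
  | nil => simp [lambdaL]
  | cons t ts ih => simp [lambdaL, ih]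

theorem lambdaL_tauStack {P : List ℤ} (h : IsForestPath P) :
    lambdaL (tauStack P) = P ∧ ((tauStack P).length : ℤ) = -P.sum := by
  induction P with
  | nil => simp [tauStack, lambdaL]
  | cons s P ih =>
    obtain ⟨h1, h2, h3⟩ := h
    obtain ⟨ih1, ih2⟩ := ih h3
    rw [tauStack_cons]
    split_ifs with hs
    · have : s = -1 := by omega
      subst this
      simp only [lambdaL, lambdaT, ih1, List.length_cons, List.sum_cons]
      exact ⟨by simp, by push_cast; omega⟩
    · simp only [lambdaL, lambdaT, List.cons_append, ← lambdaL_append, List.take_append_drop, ih1,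
        List.length_cons, List.length_take, List.length_drop, List.sum_cons, List.cons.injEq,
        and_true]
      omega

theorem IsLukas.exists_lambdaT {P : List ℤ} (h : IsLukas P) : ∃ t, P = lambdaT t := by
  obtain ⟨h1, h2⟩ := (isLukas_iff P).1 h
  obtain ⟨h3, h4⟩ := lambdaL_tauStack h1
  obtain ⟨t, ht⟩ := List.length_eq_one_iff.1 (show (tauStack P).length = 1 by omega)
  exact ⟨t, by rw [← h3, ht]; simp [lambdaL]⟩

/-! ## Area and depth as thorn counts -/

theorem internCount_node_cons (t : PTree) (ts : List PTree) :
    internCount (.node (t :: ts)) = 1 + internCountL (t :: ts) := by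
  rw [internCount]

theorem areaVecAux_lambda_append :
    (∀ t (h : ℕ) rest, ((areaVecAux h (lambdaT t ++ rest)).map Int.toNat).sum =
      h * internCount t + rthornT t + ((areaVecAux (h - 1) rest).map Int.toNat).sum) ∧
    ∀ ts (h : ℕ) rest,
      ((areaVecAux (h + ts.length - 1) (lambdaL ts ++ rest)).map Int.toNat).sum =
        h * internCountL ts + rthornL ts + ((areaVecAux (h - 1) rest).map Int.toNat).sum := by
  refine forest_induction ?_ ?_ ?_
  · intro ts ih h rest
    have e : (h : ℤ) + (ts.length - 1) = h + ts.length - 1 := by ring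
    cases ts with
    | nil => simp [lambdaT, lambdaL, areaVecAux, internCount, rthornT, rthornL, sub_eq_add_neg]
    | cons t ts =>
      rw [lambdaT, List.cons_append, areaVecAux, e, if_pos (by simp), List.map_append,
        List.sum_append, ih, internCount_node_cons, rthornT]
      simp
      ring
  · simp [lambdaL, internCountL, rthornL]
  · intro t ts h1 h2 h rest
    have e : (h : ℤ) + (t :: ts).length - 1 = (h + ts.length : ℕ) := by simp; ring
    rw [lambdaL, List.append_assoc, e, h1]
    push_cast
    rw [h2, internCountL, rthornL]
    ring

theorem area_lambdaT (t : PTree) : area (lambdaT t) = rthornT t := by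
  have := areaVecAux_lambda_append.1 t 0 []
  simpa [area, areaVec, areaVecAux] using this

theorem depthVecAux_cons_of_nonneg (cur : ℕ) (st : List ℕ) {s : ℤ} (hs : 0 ≤ s) (P : List ℤ) :
    depthVecAux cur st (s :: P) =
      cur :: depthVecAux cur ((List.range s.toNat).map (fun i => cur + i + 1) ++ st) P := by
  cases st <;> simp [depthVecAux, hs]

theorem depthVecAux_lambda_append :
    (∀ t cur st rest, ∃ c, (depthVecAux cur st (lambdaT t ++ rest)).sum =
      cur * internCount t + lthornT t + (depthVecAux (st.headD c) st.tail rest).sum) ∧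
    ∀ ts cur i st rest, ts ≠ [] → ∃ c,
      (depthVecAux (cur + i) ((List.range (ts.length - 1)).map (fun j => cur + i + j + 1) ++ st)
        (lambdaL ts ++ rest)).sum =
      cur * internCountL ts + lthornL i ts + (depthVecAux (st.headD c) st.tail rest).sum := by
  refine forest_induction ?_ ?_ ?_
  · intro ts ih cur st rest
    cases ts with
    | nil =>
      refine ⟨cur, ?_⟩
      cases st <;> simp [lambdaT, lambdaL, depthVecAux, internCount, lthornT, lthornL]
    | cons t ts =>
      obtain ⟨c, hc⟩ := ih cur 0 st rest (by simp)
      refine ⟨c, ?_⟩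
      have h' : (((t :: ts).length : ℤ) - 1).toNat = (t :: ts).length - 1 := by simp
      rw [lambdaT, List.cons_append, depthVecAux_cons_of_nonneg _ _ (by simp), h', List.sum_cons,
        internCount_node_cons, lthornT]
      simp only [add_zero] at hc
      rw [hc]
      ring
  · simp
  · intro t ts h1 h2 cur i st rest _
    cases ts with
    | nil =>
      obtain ⟨c, hc⟩ := h1 (cur + i) st rest
      refine ⟨c, ?_⟩
      simp only [lambdaL, List.append_nil, List.length_cons, List.length_nil, zero_add,
        Nat.sub_self, List.range_zero, List.map_nil, List.nil_append, internCountL, lthornL]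
      rw [hc]
      ring
    | cons u us =>
      obtain ⟨c, hc⟩ := h2 cur (i + 1) st rest (by simp)
      refine ⟨c, ?_⟩
      obtain ⟨c', hc'⟩ := h1 (cur + i)
        ((List.range ((t :: u :: us).length - 1)).map (fun j => cur + i + j + 1) ++ st)
        (lambdaL (u :: us) ++ rest)
      rw [lambdaL, List.append_assoc, hc', internCountL, lthornL]
      have e : (List.range ((t :: u :: us).length - 1)).map (fun j => cur + i + j + 1) =
          (cur + (i + 1)) ::
            (List.range ((u :: us).length - 1)).map (fun j => cur + (i + 1) + j + 1) := by
        simp only [List.length_cons, Nat.add_sub_cancel, List.range_succ_eq_map, List.map_cons,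
          List.map_map, List.cons.injEq, List.map_inj_left, Function.comp]
        exact ⟨by ring, fun a _ => by simp; ring⟩
      rw [e, List.cons_append, List.headD_cons, List.tail_cons, hc]
      ring

theorem depth_lambdaT (t : PTree) : depth (lambdaT t) = lthornT t := by
  obtain ⟨c, hc⟩ := depthVecAux_lambda_append.1 t 0 [] []
  simpa [depth, depthVec, depthVecAux] using hc

/-! ## The mirror map -/

theorem mirL_eq_map (ts : List PTree) : mirL ts = ts.map mir := by
  induction ts with
  | nil => rfl
  | cons t ts ih => simp [mirL, ih]

theorem mir_mir (t : PTree) : mir (mir t) = t := by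
  have : (∀ t, mir (mir t) = t) ∧ ∀ ts, mirL (mirL ts) = ts := by
    refine forest_induction ?_ ?_ ?_
    · intro ts ih
      rw [mirL_eq_map, mirL_eq_map] at ih
      rw [mir, mirL_eq_map, mir, mirL_eq_map, List.map_reverse, List.reverse_reverse, ih]
    · rfl
    · intro t ts h1 h2
      rw [mirL, mirL, h1, h2]
  exact this.1 t

theorem internCountL_append (ts us : List PTree) :
    internCountL (ts ++ us) = internCountL ts + internCountL us := by
  induction ts with
  | nil => simp [internCountL]
  | cons t ts ih => simp [internCountL, ih, add_assoc]

theorem internCountL_reverse (ts : List PTree) :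
    internCountL ts.reverse = internCountL ts := by
  induction ts with
  | nil => rfl
  | cons t ts ih =>
    simp only [List.reverse_cons, internCountL_append, ih, internCountL]
    ring

theorem internCount_node (ts : List PTree) :
    internCount (.node ts) = (if ts = [] then 0 else 1) + internCountL ts := by
  cases ts with
  | nil => simp [internCount, internCountL]
  | cons t ts => simp [internCount_node_cons]

theorem internCount_mir :
    (∀ t, internCount (mir t) = internCount t) ∧
      ∀ ts, internCountL (mirL ts) = internCountL ts := by
  refine forest_induction ?_ ?_ ?_
  · intro ts ih
    rw [mir, internCount_node, internCount_node, internCountL_reverse, ih, mirL_eq_map]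
    simp
  · rfl
  · intro t ts h1 h2
    rw [mirL, internCountL, internCountL, h1, h2]

theorem rthornL_append_singleton (ts : List PTree) (t : PTree) :
    rthornL (ts ++ [t]) = rthornL ts + internCountL ts + rthornT t := by
  induction ts with
  | nil => simp [rthornL, internCountL]
  | cons u us ih =>
    simp only [List.cons_append, rthornL, ih, internCountL, List.length_append,
      List.length_singleton]
    ring

theorem lthornL_succ (i : ℕ) (ts : List PTree) :
    lthornL (i + 1) ts = lthornL i ts + internCountL ts := by
  induction ts generalizing i with
  | nil => simp [lthornL, internCountL]
  | cons t ts ih =>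
    simp only [lthornL, ih, internCountL]
    ring

theorem rthornT_mir (t : PTree) : rthornT (mir t) = lthornT t := by
  have : (∀ t, rthornT (mir t) = lthornT t) ∧ ∀ ts, rthornL (mirL ts).reverse = lthornL 0 ts := by
    refine forest_induction ?_ ?_ ?_
    · intro ts ih
      rw [mir, rthornT, ih, lthornT]
    · rfl
    · intro t ts h1 h2
      rw [mirL, List.reverse_cons, rthornL_append_singleton, h2, h1, internCountL_reverse,
        internCount_mir.2, lthornL, lthornL_succ]
      ring
  exact this.1 t

theorem lthornT_mir (t : PTree) : lthornT (mir t) = rthornT t := by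
  rw [← rthornT_mir, mir_mir]

/-! ## Lodestars and skeletons -/

mutual
/-- The skeleton of a tree: each lodestar is replaced by a node with a single pendant leaf. -/
def skel : PTree → PTree
  | .node ts => if isLodestarNode (.node ts) then .node [.node []] else .node (skelL ts)
def skelL : List PTree → List PTree
  | [] => []
  | t :: ts => skel t :: skelL ts
end

mutual
/-- The subtrees rooted at the internal nodes all of whose children are leaves, in preorder. -/
def lodes : PTree → List PTree
  | .node ts => if isLodestarNode (.node ts) then [.node ts] else lodesL ts
def lodesL : List PTree → List PTree
  | [] => []
  | t :: ts => lodes t ++ lodesL ts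
end

theorem isLodestarNode_iff (ts : List PTree) :
    isLodestarNode (.node ts) = true ↔ ts ≠ [] ∧ ∀ t ∈ ts, t = .node [] := by
  have : ∀ t : PTree, children t = [] ↔ t = .node [] := by rintro ⟨ts⟩; simp [children]
  simp only [isLodestarNode, List.isEmpty_iff, Bool.and_eq_true, List.all_eq_true, this,
    Bool.not_eq_true', List.isEmpty_eq_false_iff]
  rfl

theorem skelL_eq_map (ts : List PTree) : skelL ts = ts.map skel := by
  induction ts with
  | nil => rfl
  | cons t ts ih => simp [skelL, ih]

theorem skel_eq_leaf_iff (t : PTree) : skel t = .node [] ↔ t = .node [] := by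
  obtain ⟨ts⟩ := t
  rw [skel]
  split_ifs with h
  · have := ((isLodestarNode_iff ts).1 h).1
    simp [this]
  · simp [skelL_eq_map]

theorem isLodestarNode_skelL (ts : List PTree) :
    isLodestarNode (.node (skelL ts)) = isLodestarNode (.node ts) := by
  rw [Bool.eq_iff_iff, isLodestarNode_iff, isLodestarNode_iff]
  simp [skelL_eq_map, skel_eq_leaf_iff]

theorem isLodestarNode_skel (t : PTree) : isLodestarNode (skel t) = isLodestarNode t := by
  obtain ⟨ts⟩ := t
  rw [skel]
  split_ifs with h
  · rw [h, isLodestarNode_iff]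
    simp
  · exact isLodestarNode_skelL ts

theorem lodes_eq_nil :
    (∀ t, lodes t = [] ↔ t = .node []) ∧ ∀ ts, lodesL ts = [] ↔ ∀ t ∈ ts, t = .node [] := by
  refine forest_induction ?_ ?_ ?_
  · intro ts ih
    rw [lodes]
    split_ifs with h
    · simp [((isLodestarNode_iff ts).1 h).1]
    · rw [isLodestarNode_iff] at h
      rw [ih, PTree.node.injEq]
      constructor
      · intro h'; by_contra h''; exact h ⟨h'', h'⟩
      · rintro rfl; simp
  · simp [lodesL]
  · intro t ts h1 h2
    simp [lodesL, h1, h2]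

theorem lodesL_ne_nil {ts : List PTree} (h : isLodestarNode (.node ts) ≠ true) (hts : ts ≠ []) :
    lodesL ts ≠ [] := by
  rw [Ne, lodes_eq_nil.2]
  exact fun h' => h ((isLodestarNode_iff ts).2 ⟨hts, h'⟩)

theorem isLodestarNode_of_mem_lodes :
    (∀ t, ∀ s ∈ lodes t, isLodestarNode s = true) ∧
      ∀ ts, ∀ s ∈ lodesL ts, isLodestarNode s = true := by
  refine forest_induction ?_ ?_ ?_
  · intro ts ih s
    rw [lodes]
    split_ifs with h
    · rw [List.mem_singleton]; rintro rfl; exact h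
    · exact ih s
  · simp [lodesL]
  · intro t ts h1 h2 s hs
    rw [lodesL, List.mem_append] at hs
    exact hs.elim (h1 s) (h2 s)

theorem lodes_of_isLodestarNode {s : PTree} (h : isLodestarNode s = true) : lodes s = [s] := by
  obtain ⟨ts⟩ := s
  rw [lodes, if_pos h]

theorem skel_of_isLodestarNode {s : PTree} (h : isLodestarNode s = true) :
    skel s = .node [.node []] := by
  obtain ⟨ts⟩ := s
  rw [skel, if_pos h]

theorem length_lodes_skel :
    (∀ t, (lodes (skel t)).length = (lodes t).length) ∧
      ∀ ts, (lodesL (skelL ts)).length = (lodesL ts).length := by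
  refine forest_induction ?_ ?_ ?_
  · intro ts ih
    rw [skel, lodes]
    split_ifs with h
    · simp [lodes, isLodestarNode, children]
    · rw [lodes, isLodestarNode_skelL, if_neg h, ih]
  · rfl
  · intro t ts h1 h2
    rw [skelL, lodesL, lodesL, List.length_append, List.length_append, h1, h2]

theorem eq_of_skel_eq_of_lodes_eq :
    (∀ t u, skel t = skel u → lodes t = lodes u → t = u) ∧
      ∀ ts us, skelL ts = skelL us → lodesL ts = lodesL us → ts = us := by
  refine forest_induction ?_ ?_ ?_
  · rintro ts ih ⟨us⟩ h1 h2
    have h := congrArg isLodestarNode h1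
    rw [isLodestarNode_skel, isLodestarNode_skel] at h
    rw [skel, skel, ← h] at h1
    rw [lodes, lodes, ← h] at h2
    split_ifs at h1 h2 with h3
    · simpa using h2
    · rw [ih us (by simpa using h1) h2]
  · intro us h1 _
    rw [skelL_eq_map, skelL_eq_map] at h1
    simpa using h1.symm
  · intro t ts h1 h2 us h3 h4
    cases us with
    | nil => simp [skelL] at h3
    | cons u us =>
      simp only [skelL, List.cons.injEq] at h3
      have hl : (lodes t).length = (lodes u).length := by
        rw [← length_lodes_skel.1 t, h3.1, length_lodes_skel.1]
      obtain ⟨h5, h6⟩ := List.append_inj h4 hl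
      rw [h1 u h3.1 h5, h2 us h3.2 h6]

theorem leftLode?_eq :
    (∀ t, leftLode? t = (lodes t).head?) ∧ ∀ ts, leftLodeL? ts = (lodesL ts).head? := by
  refine forest_induction ?_ ?_ ?_
  · intro ts ih
    rw [leftLode?, lodes]
    split_ifs <;> simp [ih]
  · rfl
  · intro t ts h1 h2
    rw [leftLodeL?, lodesL, h1, h2, List.head?_append]
    cases (lodes t).head? <;> simp

theorem rightLode?_eq :
    (∀ t, rightLode? t = (lodes t).getLast?) ∧ ∀ ts, rightLodeL? ts = (lodesL ts).getLast? := by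
  refine forest_induction ?_ ?_ ?_
  · intro ts ih
    rw [rightLode?, lodes, ih]
    split_ifs with h
    · simp [lodes_eq_nil.2 ts |>.2 ((isLodestarNode_iff ts).1 h).2]
    · cases (lodesL ts).getLast? <;> simp
  · rfl
  · intro t ts h1 h2
    rw [rightLodeL?, lodesL, h1, h2, List.getLast?_append]
    cases (lodesL ts).getLast? <;> simp

theorem replF_spec {s : PTree} (hs : isLodestarNode s = true) :
    (∀ t, (lodes t = [] ∧ replF s t = none) ∨ ∃ t' x l, replF s t = some t' ∧
      skel t' = skel t ∧ lodes t = x :: l ∧ lodes t' = s :: l) ∧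
    ∀ ts, (lodesL ts = [] ∧ replFL s ts = none) ∨ ∃ ts' x l, replFL s ts = some ts' ∧
      skelL ts' = skelL ts ∧ lodesL ts = x :: l ∧ lodesL ts' = s :: l := by
  refine forest_induction ?_ ?_ ?_
  · intro ts ih
    rw [replF, lodes]
    split_ifs with h
    · exact .inr ⟨s, .node ts, [], rfl, by rw [skel_of_isLodestarNode hs, skel_of_isLodestarNode h],
        rfl, lodes_of_isLodestarNode hs⟩
    · rcases ih with ⟨h1, h2⟩ | ⟨ts', x, l, h1, h2, h3, h4⟩
      · exact .inl ⟨h1, by simp [h2]⟩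
      · have h5 : isLodestarNode (.node ts') ≠ true := by
          rwa [← isLodestarNode_skelL, h2, isLodestarNode_skelL]
        refine .inr ⟨.node ts', x, l, by simp [h1], ?_, h3, ?_⟩
        · rw [skel, skel, if_neg h, if_neg h5, h2]
        · rw [lodes, if_neg h5, h4]
  · exact .inl ⟨rfl, by rw [replFL]⟩
  · intro t ts h1 h2
    rw [replFL, lodesL]
    rcases h1 with ⟨h1, h3⟩ | ⟨t', x, l, h1, h3, h4, h5⟩
    · rcases h2 with ⟨h2, h4⟩ | ⟨ts', x, l, h2, h4, h5, h6⟩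
      · exact .inl ⟨by simp [h1, h2], by simp [h3, h4]⟩
      · exact .inr ⟨t :: ts', x, l, by simp [h3, h2], by simp [skelL, h4], by simp [h1, h5],
          by simp [lodesL, h1, h6]⟩
    · exact .inr ⟨t' :: ts, x, l ++ lodesL ts, by simp [h1], by simp [skelL, h3], by simp [h4],
        by simp [lodesL, h5]⟩

theorem replL_spec {s : PTree} (hs : isLodestarNode s = true) :
    (∀ t, (lodes t = [] ∧ replL s t = none) ∨ ∃ t' x l, replL s t = some t' ∧
      skel t' = skel t ∧ lodes t = l ++ [x] ∧ lodes t' = l ++ [s]) ∧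
    ∀ ts, (lodesL ts = [] ∧ replLL s ts = none) ∨ ∃ ts' x l, replLL s ts = some ts' ∧
      skelL ts' = skelL ts ∧ lodesL ts = l ++ [x] ∧ lodesL ts' = l ++ [s] := by
  refine forest_induction ?_ ?_ ?_
  · intro ts ih
    rw [replL, lodes]
    split_ifs with h
    · have h0 := (lodes_eq_nil.2 ts).2 ((isLodestarNode_iff ts).1 h).2
      have h1 : replLL s ts = none := by
        rcases ih with ⟨-, h1⟩ | ⟨_, _, _, -, -, h1, -⟩
        · exact h1
        · simp [h0] at h1
      exact .inr ⟨s, .node ts, [], by simp [h1],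
        by rw [skel_of_isLodestarNode hs, skel_of_isLodestarNode h],
        rfl, lodes_of_isLodestarNode hs⟩
    · rcases ih with ⟨h1, h2⟩ | ⟨ts', x, l, h1, h2, h3, h4⟩
      · exact .inl ⟨h1, by simp [h2]⟩
      · have h5 : isLodestarNode (.node ts') ≠ true := by
          rwa [← isLodestarNode_skelL, h2, isLodestarNode_skelL]
        refine .inr ⟨.node ts', x, l, by simp [h1], ?_, h3, ?_⟩
        · rw [skel, skel, if_neg h, if_neg h5, h2]
        · rw [lodes, if_neg h5, h4]
  · exact .inl ⟨rfl, by rw [replLL]⟩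
  · intro t ts h1 h2
    rw [replLL, lodesL]
    rcases h2 with ⟨h2, h4⟩ | ⟨ts', x, l, h2, h4, h5, h6⟩
    · rcases h1 with ⟨h1, h3⟩ | ⟨t', x, l, h1, h3, h6, h5⟩
      · exact .inl ⟨by simp [h1, h2], by simp [h3, h4]⟩
      · exact .inr ⟨t' :: ts, x, l, by simp [h1, h4], by simp [skelL, h3], by simp [h6, h2],
          by simp [lodesL, h5, h2]⟩
    · exact .inr ⟨t :: ts', x, lodes t ++ l, by simp [h2], by simp [skelL, h4], by simp [h5],
        by simp [lodesL, h6]⟩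

/-- Exchange the first and the last entry of a list. -/
def swapEnds {α : Type*} (l : List α) : List α :=
  match l.head?, l.getLast? with
  | some x, some y => (y :: l.tail).dropLast ++ [x]
  | _, _ => l

theorem swapEnds_cons_concat {α : Type*} (x y : α) (l : List α) :
    swapEnds (x :: (l ++ [y])) = y :: (l ++ [x]) := by
  have : (x :: (l ++ [y])).getLast? = some y := by
    rw [← List.cons_append, List.getLast?_concat]
  rw [swapEnds, this, List.head?_cons]
  change (y :: (l ++ [y])).dropLast ++ [x] = _
  rw [← List.cons_append, List.dropLast_concat, List.cons_append]

theorem list_ends_cases {α : Type*} (l : List α) :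
    l = [] ∨ (∃ x, l = [x]) ∨ ∃ x m y, l = x :: (m ++ [y]) := by
  rcases l with _ | ⟨x, l⟩
  · simp
  · rcases List.eq_nil_or_concat' l with rfl | ⟨m, y, rfl⟩
    · simp
    · exact .inr (.inr ⟨x, m, y, rfl⟩)

theorem swapEnds_reverse_swapEnds_reverse {α : Type*} (l : List α) :
    swapEnds (swapEnds l.reverse).reverse = l := by
  rcases list_ends_cases l with rfl | ⟨x, rfl⟩ | ⟨x, m, y, rfl⟩
  · rfl
  · rfl
  · simp [swapEnds_cons_concat]

theorem getLast?_swapEnds {α : Type*} (l : List α) : (swapEnds l).getLast? = l.head? := by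
  rcases list_ends_cases l with rfl | ⟨x, rfl⟩ | ⟨x, m, y, rfl⟩
  · rfl
  · rfl
  · rw [swapEnds_cons_concat, ← List.cons_append, List.getLast?_concat, List.head?_cons]

theorem swapEnds_perm {α : Type*} (l : List α) : (swapEnds l).Perm l := by
  rcases list_ends_cases l with rfl | ⟨x, rfl⟩ | ⟨x, m, y, rfl⟩
  · rfl
  · rfl
  · rw [swapEnds_cons_concat]
    have h : ∀ a b : α, (a :: (m ++ [b])).Perm (a :: b :: m) := fun a b =>
      (List.perm_append_singleton b m).cons a
    exact ((h y x).trans (.swap x y m)).trans (h x y).symm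

theorem lodeSwap_spec (t : PTree) :
    skel (lodeSwap t) = skel t ∧ lodes (lodeSwap t) = swapEnds (lodes t) := by
  rw [lodeSwap, leftLode?_eq.1, rightLode?_eq.1, swapEnds]
  rcases hx : (lodes t).head? with _ | x
  · simp
  rcases hy : (lodes t).getLast? with _ | y
  · simp
  have hx' := isLodestarNode_of_mem_lodes.1 t x (List.mem_of_mem_head? hx)
  have hy' := isLodestarNode_of_mem_lodes.1 t y (List.mem_of_getLast? hy)
  rcases (replF_spec hy').1 t with ⟨h, -⟩ | ⟨t', z, l, h1, h2, h3, h4⟩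
  · simp [h] at hx
  rcases (replL_spec hx').1 t' with ⟨h, -⟩ | ⟨t'', w, m, h5, h6, h7, h8⟩
  · simp [h] at h4
  simp only [h1, h5, Option.bind_some, Option.getD_some]
  refine ⟨h6.trans h2, ?_⟩
  rw [h8, h3, List.tail_cons, ← h4, h7, List.dropLast_concat]

theorem isLodestarNode_mirL_reverse (ts : List PTree) :
    isLodestarNode (.node (mirL ts).reverse) = isLodestarNode (.node ts) := by
  have h : ∀ t, mir t = .node [] ↔ t = .node [] := by
    rintro ⟨us⟩; simp [mir, mirL_eq_map]
  rw [Bool.eq_iff_iff, isLodestarNode_iff, isLodestarNode_iff]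
  simp [mirL_eq_map, h]

theorem mir_of_isLodestarNode {s : PTree} (h : isLodestarNode s = true) : mir s = s := by
  obtain ⟨ts⟩ := s
  have h' := (isLodestarNode_iff ts).1 h
  obtain ⟨n, rfl⟩ : ∃ n, ts = List.replicate n (.node []) :=
    ⟨ts.length, List.eq_replicate_of_mem h'.2⟩
  simp [mir, mirL_eq_map, mirL]

theorem lodesL_append (ts us : List PTree) :
    lodesL (ts ++ us) = lodesL ts ++ lodesL us := by
  induction ts with
  | nil => simp [lodesL]
  | cons t ts ih => simp [lodesL, ih]

theorem mir_spec :
    (∀ t, skel (mir t) = mir (skel t) ∧ lodes (mir t) = (lodes t).reverse) ∧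
    ∀ ts, skelL (mirL ts) = mirL (skelL ts) ∧
      lodesL (mirL ts).reverse = (lodesL ts).reverse := by
  refine forest_induction ?_ ?_ ?_
  · rintro ts ⟨h1, h2⟩
    by_cases h : isLodestarNode (.node ts) = true
    · rw [mir_of_isLodestarNode h, lodes_of_isLodestarNode h, skel_of_isLodestarNode h]
      simp [mir, mirL]
    · rw [mir, skel, skel, lodes, lodes, isLodestarNode_mirL_reverse, if_neg h, if_neg h, if_neg h,
        if_neg h, mir, ← h1, h2]
      simp [skelL_eq_map]
  · simp [mirL, skelL, lodesL]
  · rintro t ts ⟨h1, h2⟩ ⟨h3, h4⟩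
    simp [mirL, skelL, lodesL, lodesL_append, h1, h2, h3, h4]

theorem lodeSwap_mir_lodeSwap_mir (t : PTree) : lodeSwap (mir (lodeSwap (mir t))) = t := by
  apply eq_of_skel_eq_of_lodes_eq.1
  · rw [(lodeSwap_spec _).1, (mir_spec.1 _).1, (lodeSwap_spec _).1, (mir_spec.1 _).1, mir_mir]
  · rw [(lodeSwap_spec _).2, (mir_spec.1 _).2, (lodeSwap_spec _).2, (mir_spec.1 _).2,
      swapEnds_reverse_swapEnds_reverse]

/-! ## Invariance under the lodestar swap -/

theorem thorn_of_forall_leaf {ts : List PTree} (h : ∀ t ∈ ts, t = .node []) :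
    internCountL ts = 0 ∧ rthornL ts = 0 ∧ ∀ i, lthornL i ts = 0 := by
  induction ts with
  | nil => simp [internCountL, rthornL, lthornL]
  | cons t ts ih =>
    obtain rfl : t = .node [] := h t (by simp)
    obtain ⟨h1, h2, h3⟩ := ih fun u hu => h u (by simp [hu])
    simp [internCountL, rthornL, lthornL, internCount, rthornT, lthornT, h1, h2, h3]

theorem thorn_skel :
    (∀ t, internCount (skel t) = internCount t ∧ lthornT (skel t) = lthornT t ∧
      rthornT (skel t) = rthornT t) ∧
    ∀ ts, internCountL (skelL ts) = internCountL ts ∧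
      (∀ i, lthornL i (skelL ts) = lthornL i ts) ∧ rthornL (skelL ts) = rthornL ts := by
  refine forest_induction ?_ ?_ ?_
  · rintro ts ⟨h1, h2, h3⟩
    rw [skel]
    split_ifs with h
    · obtain ⟨h4, h5⟩ := (isLodestarNode_iff ts).1 h
      obtain ⟨h6, h7, h8⟩ := thorn_of_forall_leaf h5
      rw [internCount_node, internCount_node, if_neg h4, h6]
      simp [lthornT, rthornT, h7, h8, internCount, internCountL, lthornL, rthornL]
    · rw [internCount_node, internCount_node, lthornT, lthornT, rthornT, rthornT, h1, h2, h3]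
      simp [skelL_eq_map]
  · simp [skelL]
  · rintro t ts ⟨h1, h2, h3⟩ ⟨h4, h5, h6⟩
    have h7 : (skelL ts).length = ts.length := by simp [skelL_eq_map]
    simp [skelL, internCountL, lthornL, rthornL, h1, h2, h3, h4, h5, h6, h7]

theorem lthornT_lodeSwap (t : PTree) : lthornT (lodeSwap t) = lthornT t := by
  rw [← (thorn_skel.1 _).2.1, (lodeSwap_spec t).1, (thorn_skel.1 _).2.1]

theorem rthornT_lodeSwap (t : PTree) : rthornT (lodeSwap t) = rthornT t := by
  rw [← (thorn_skel.1 _).2.2, (lodeSwap_spec t).1, (thorn_skel.1 _).2.2]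

theorem upDegs_append (P Q : List ℤ) : upDegs (P ++ Q) = upDegs P ++ upDegs Q := by
  simp [upDegs]

theorem upDegs_lambdaT (ts : List PTree) :
    upDegs (lambdaT (.node ts)) =
      if ts = [] then [] else (ts.length - 1) :: upDegs (lambdaL ts) := by
  cases ts with
  | nil => simp [lambdaT, lambdaL, upDegs]
  | cons t ts => simp [lambdaT, upDegs]

theorem firstUp?_lambdaT (t : PTree) :
    firstUp? (lambdaT t) = if numChildren t = 0 then none else some (numChildren t - 1) := by
  obtain ⟨ts⟩ := t
  rw [firstUp?, upDegs_lambdaT]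
  cases ts <;> simp [numChildren, children]

theorem upDegs_lambdaL_of_forall_leaf {ts : List PTree} (h : ∀ t ∈ ts, t = .node []) :
    upDegs (lambdaL ts) = [] := by
  induction ts with
  | nil => simp [lambdaL, upDegs]
  | cons t ts ih =>
    obtain rfl : t = .node [] := h t (by simp)
    rw [lambdaL, upDegs_append, ih fun u hu => h u (by simp [hu]), upDegs_lambdaT]
    simp

theorem upDegs_lambdaT_of_isLodestarNode {s : PTree} (h : isLodestarNode s = true) :
    upDegs (lambdaT s) = [numChildren s - 1] := by
  obtain ⟨ts⟩ := s
  obtain ⟨h1, h2⟩ := (isLodestarNode_iff ts).1 h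
  rw [upDegs_lambdaT, if_neg h1, upDegs_lambdaL_of_forall_leaf h2, numChildren, children]

theorem lastUp?_lambda :
    (∀ t, lastUp? (lambdaT t) = (lodes t).getLast?.map (fun s => numChildren s - 1)) ∧
    ∀ ts, lastUp? (lambdaL ts) = (lodesL ts).getLast?.map (fun s => numChildren s - 1) := by
  simp only [lastUp?]
  refine forest_induction ?_ ?_ ?_
  · intro ts ih
    by_cases h : isLodestarNode (.node ts) = true
    · rw [upDegs_lambdaT_of_isLodestarNode h, lodes_of_isLodestarNode h]
      rfl
    · rw [upDegs_lambdaT, lodes, if_neg h]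
      split_ifs with hts
      · simp [hts, lodesL]
      · rw [List.getLast?_cons, ih]
        have := lodesL_ne_nil h hts
        simp [List.getLast?_eq_getLast_of_ne_nil this]
  · simp [lambdaL, lodesL, upDegs]
  · intro t ts h1 h2
    rw [lambdaL, upDegs_append, lodesL, List.getLast?_append, List.getLast?_append, h1, h2]
    cases (lodesL ts).getLast? <;> simp

theorem upDegs_lambdaL_reverse_perm (ts : List PTree) :
    (upDegs (lambdaL ts.reverse)).Perm (upDegs (lambdaL ts)) := by
  induction ts with
  | nil => rfl
  | cons t ts ih =>
    simp only [List.reverse_cons, lambdaL_append, lambdaL, upDegs_append, List.append_nil]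
    exact List.perm_append_comm.trans (ih.append_left _)

theorem upDegs_mir_perm :
    (∀ t, (upDegs (lambdaT (mir t))).Perm (upDegs (lambdaT t))) ∧
    ∀ ts, (upDegs (lambdaL (mirL ts))).Perm (upDegs (lambdaL ts)) := by
  refine forest_induction ?_ ?_ ?_
  · intro ts ih
    rw [mir, upDegs_lambdaT, upDegs_lambdaT]
    have h : (mirL ts).reverse = [] ↔ ts = [] := by simp [mirL_eq_map]
    have h' : (mirL ts).reverse.length = ts.length := by simp [mirL_eq_map]
    simp only [h, h']
    split_ifs
    · rfl
    · exact ((upDegs_lambdaL_reverse_perm _).trans ih).cons _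
  · rfl
  · intro t ts h1 h2
    simp only [mirL, lambdaL, upDegs_append]
    exact h1.append h2

theorem profileM_skel :
    (∀ t, profileM (lambdaT t) + (lodes t : Multiset PTree).map (fun _ => 0) =
      profileM (lambdaT (skel t)) + (lodes t : Multiset PTree).map (fun s => numChildren s - 1)) ∧
    ∀ ts, profileM (lambdaL ts) + (lodesL ts : Multiset PTree).map (fun _ => 0) =
      profileM (lambdaL (skelL ts)) + (lodesL ts : Multiset PTree).map (fun s => numChildren s - 1) := by
  simp only [profileM]
  refine forest_induction ?_ ?_ ?_
  · intro ts ih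
    by_cases h : isLodestarNode (.node ts) = true
    · rw [upDegs_lambdaT_of_isLodestarNode h, skel_of_isLodestarNode h,
        upDegs_lambdaT_of_isLodestarNode (by simp [isLodestarNode, children]),
        lodes_of_isLodestarNode h, add_comm]
      rfl
    · rw [skel, lodes, if_neg h, if_neg h, upDegs_lambdaT, upDegs_lambdaT]
      have h1 : skelL ts = [] ↔ ts = [] := by simp [skelL_eq_map]
      have h2 : (skelL ts).length = ts.length := by simp [skelL_eq_map]
      simp only [h1, h2]
      split_ifs with hts
      · simp [hts, lodesL]
      · rw [← Multiset.cons_coe, ← Multiset.cons_coe, Multiset.cons_add, Multiset.cons_add, ih]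
  · simp [skelL, lodesL]
  · intro t ts h1 h2
    simp only [skelL, lambdaL, lodesL, upDegs_append, ← Multiset.coe_add, Multiset.map_add]
    rw [add_add_add_comm, h1, h2, add_add_add_comm]

theorem profileM_lodeSwap (t : PTree) :
    profileM (lambdaT (lodeSwap t)) = profileM (lambdaT t) := by
  have h1 := profileM_skel.1 (lodeSwap t)
  rw [(lodeSwap_spec t).1, (lodeSwap_spec t).2,
    Multiset.coe_eq_coe.2 (swapEnds_perm (lodes t)), ← profileM_skel.1 t] at h1
  exact add_right_cancel h1

theorem profileM_lodeSwap_mir (t : PTree) :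
    profileM (lambdaT (lodeSwap (mir t))) = profileM (lambdaT t) := by
  rw [profileM_lodeSwap]
  exact Multiset.coe_eq_coe.2 (upDegs_mir_perm.1 t)

theorem lastUp?_lodeSwap_mir (t : PTree) :
    lastUp? (lambdaT (lodeSwap (mir t))) = lastUp? (lambdaT t) := by
  rw [lastUp?_lambda.1, lastUp?_lambda.1, (lodeSwap_spec _).2, getLast?_swapEnds,
    (mir_spec.1 t).2, List.head?_reverse]

theorem numChildren_skel {t : PTree} (h : isLodestarNode t ≠ true) :
    numChildren (skel t) = numChildren t := by
  obtain ⟨ts⟩ := t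
  rw [skel, if_neg h]
  simp [numChildren, children, skelL_eq_map]

theorem numChildren_mir (t : PTree) : numChildren (mir t) = numChildren t := by
  obtain ⟨ts⟩ := t
  simp [numChildren, children, mir, mirL_eq_map]

theorem firstUp?_lodeSwap_mir {t : PTree} (h : 2 ≤ (profileM (lambdaT t)).card) :
    firstUp? (lambdaT (lodeSwap (mir t))) = firstUp? (lambdaT t) := by
  have key : ∀ u, 2 ≤ (profileM (lambdaT u)).card → isLodestarNode u ≠ true := by
    intro u hu hl
    simp [profileM, upDegs_lambdaT_of_isLodestarNode hl] at hu
  rw [firstUp?_lambdaT, firstUp?_lambdaT, ← numChildren_skel (key t h),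
    ← numChildren_skel (key (lodeSwap (mir t)) (by rwa [profileM_lodeSwap_mir])),
    (lodeSwap_spec _).1, (mir_spec.1 t).1, numChildren_mir]

end Luka


open Luka in
/-- The map `λ ∘ swap ∘ mir ∘ τ` is an involution on `𝓛_{a,M,b}` exchanging `area`
and `depth`: it maps `𝓛_{a,M,b}` to itself, applying it twice is the identity, and
for `P' = λ(swap(mir(τ(P))))` one has `area(P') = depth(P)` and
`depth(P') = area(P)`. -/
theorem lambda_swap_mir_tau_involution (a b : ℕ) (M : Multiset ℕ) :
    (∀ P, MemLab a M b P → MemLab a M b (lambdaT (lodeSwap (mir (tau P))))) ∧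
    (∀ P, MemLab a M b P →
      lambdaT (lodeSwap (mir (tau (lambdaT (lodeSwap (mir (tau P))))))) = P) ∧
    (∀ P, MemLab a M b P →
      area (lambdaT (lodeSwap (mir (tau P)))) = depth P ∧
      depth (lambdaT (lodeSwap (mir (tau P)))) = area P) := by
  refine ⟨fun P hP => ?_, fun P hP => ?_, fun P hP => ?_⟩ <;>
    obtain ⟨t, rfl⟩ := hP.1.exists_lambdaT
  · obtain ⟨-, h1, h2, h3⟩ := hP
    rw [tau_lambdaT]
    refine ⟨isLukas_lambdaT _, ?_, ?_, ?_⟩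
    · rw [firstUp?_lodeSwap_mir (by simp [h3]), h1]
    · rw [lastUp?_lodeSwap_mir, h2]
    · rw [profileM_lodeSwap_mir, h3]
  · rw [tau_lambdaT, tau_lambdaT, lodeSwap_mir_lodeSwap_mir]
  · rw [tau_lambdaT, area_lambdaT, depth_lambdaT, area_lambdaT, depth_lambdaT, rthornT_lodeSwap,
      lthornT_lodeSwap, rthornT_mir, lthornT_mir]
    exact ⟨rfl, rfl⟩
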